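/- Let N ≥ 1, n ≥ 1, p ∈ {1,…,N} ∪ (N,∞), and let W be a random N×N Hermitian matrix with complex Wishart law W(I_N, p), where I_N is the N×N identity matrix. For a partition λ = (λ_1, λ_2, …) of n, define p_λ(x) = tr(x^{λ_1}) tr(x^{λ_2}) ⋯ . If σ ∈ S_n has cycle type λ, then E( p_λ(W) ) = Σ_{α ∈ S_n} p^{#C(α)} N^{#C(ασ)}. -/

import Mathlib

open MeasureTheory ProbabilityTheory Matrix Filter
open scoped ComplexOrder

noncomputable section

/-- The measurable space structure on complex matrices (entrywise/product σ-algebra). -/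
instance matMS (N : ℕ) : MeasurableSpace (Matrix (Fin N) (Fin N) ℂ) :=
  inferInstanceAs (MeasurableSpace (Fin N → Fin N → ℂ))

/-- The set of minimal representatives of the cycles of a permutation. -/
def cycleReps {β : Type*} [Fintype β] [LinearOrder β] (π : Equiv.Perm β) : Finset β :=
  Finset.univ.filter fun j => ∀ i ∈ Finset.range (Fintype.card β), j ≤ (π ^ i) j

/-- The number of cycles of a permutation (fixed points count as cycles of length one). -/
def cycleCount {β : Type*} [Fintype β] [LinearOrder β] (π : Equiv.Perm β) : ℕ :=
  (cycleReps π).card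

/-- The product `f j * f (π j) * f (π² j) * ⋯` along the cycle of `π` containing `j`. -/
def cycleProd {β M : Type*} [Monoid M] (π : Equiv.Perm β) (f : β → M) (j : β) : M :=
  ((List.range (Function.minimalPeriod ⇑π j)).map fun i => f ((π ^ i) j)).prod

/-- `q_{σ,t,h}(x₁,…,x_s) = ∏_{c ∈ C(σ)} tr (∏_{j ∈ c} h(j) x_{t(j)})`, the product inside each
trace being taken in the order in which the elements appear along the cycle. -/
def qMonomial {n N s : ℕ} (σ : Equiv.Perm (Fin n)) (t : Fin n → Fin s)
    (h : Fin n → Matrix (Fin N) (Fin N) ℂ) (x : Fin s → Matrix (Fin N) (Fin N) ℂ) : ℂ :=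
  ∏ j ∈ cycleReps σ, (cycleProd σ (fun i => h i * x (t i)) j).trace

/-- `p ∈ {1,…,N} ∪ (N,∞)`. -/
def ShapeParam (N : ℕ) (p : ℝ) : Prop :=
  (∃ k : ℕ, 1 ≤ k ∧ k ≤ N ∧ p = k) ∨ (N : ℝ) < p

/-- `W` has the complex Wishart law with scale `S` and shape `p`: it is Hermitian valued and its
Laplace transform is `det(I - θ S)^{-p}` for all Hermitian `θ` with `S⁻¹ - θ` positive definite. -/
def IsWishart {N : ℕ} {Ω : Type*} [MeasurableSpace Ω] (μ : Measure Ω)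
    (W : Ω → Matrix (Fin N) (Fin N) ℂ) (S : Matrix (Fin N) (Fin N) ℂ) (p : ℝ) : Prop :=
  (∀ ω, (W ω).IsHermitian) ∧
    ∀ θ : Matrix (Fin N) (Fin N) ℂ, θ.IsHermitian → (S⁻¹ - θ).PosDef →
      ∫ ω, Complex.exp ((θ * W ω).trace) ∂μ = (1 - θ * S).det ^ (-(p : ℂ))

section Combinatorics

lemma minimalPeriod_perm_pos {β : Type*} [Finite β] (π : Equiv.Perm β) (j : β) :
    0 < Function.minimalPeriod π j :=
  Function.minimalPeriod_pos_of_mem_periodicPts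
    (Function.Injective.mem_periodicPts π.injective j)

variable {β : Type*} [Fintype β] [LinearOrder β]

lemma mem_cycleReps_iff (π : Equiv.Perm β) (j : β) :
    j ∈ cycleReps π ↔ ∀ x, π.SameCycle j x → j ≤ x := by
  constructor
  · intro h x hx
    obtain ⟨i, rfl⟩ := hx.exists_nat_pow_eq
    have hlt : i % Function.minimalPeriod π j ∈ Finset.range (Fintype.card β) :=
      Finset.mem_range.2 ((Nat.mod_lt _ (minimalPeriod_perm_pos π j)).trans_le
        Function.minimalPeriod_le_card)
    have := (Finset.mem_filter.1 h).2 _ hlt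
    rwa [← Equiv.Perm.iterate_eq_pow, Function.iterate_mod_minimalPeriod_eq,
      Equiv.Perm.iterate_eq_pow] at this
  · exact fun h => Finset.mem_filter.2 ⟨Finset.mem_univ _, fun i _ => h _ ⟨i, by simp⟩⟩

lemma cycleReps_orbit_bijective (π : Equiv.Perm β) :
    Function.Bijective fun x : (Σ r : cycleReps π, Fin (Function.minimalPeriod π (r : β))) =>
      (π ^ (x.2 : ℕ)) (x.1 : β) := by
  constructor
  · rintro ⟨⟨r, hr⟩, i⟩ ⟨⟨s, hs⟩, k⟩ h
    simp only at h i k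
    have h1 : π.SameCycle r s := by
      have hr' : π.SameCycle r ((π ^ (i : ℕ)) r) := ⟨i, by simp⟩
      have hs' : π.SameCycle s ((π ^ (k : ℕ)) s) := ⟨k, by simp⟩
      exact hr'.trans (h ▸ hs'.symm)
    obtain rfl : r = s := le_antisymm ((mem_cycleReps_iff π r).1 hr _ h1)
      ((mem_cycleReps_iff π s).1 hs _ h1.symm)
    have : i = k := by
      rw [← Equiv.Perm.iterate_eq_pow, ← Equiv.Perm.iterate_eq_pow] at h
      exact Fin.ext (Function.iterate_injOn_Iio_minimalPeriod i.2 k.2 h)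
    rw [this]
  · intro j
    classical
    let S : Finset β := Finset.univ.filter fun x => π.SameCycle j x
    have hS : S.Nonempty := ⟨j, by simp [S, Equiv.Perm.SameCycle.refl]⟩
    have hm : π.SameCycle j (S.min' hS) := (Finset.mem_filter.1 (S.min'_mem hS)).2
    have hrep : S.min' hS ∈ cycleReps π := (mem_cycleReps_iff _ _).2 fun x hx =>
      S.min'_le x (Finset.mem_filter.2 ⟨Finset.mem_univ _, hm.trans hx⟩)
    obtain ⟨i, hi⟩ := hm.symm.exists_nat_pow_eq
    refine ⟨⟨⟨_, hrep⟩, ⟨i % _, Nat.mod_lt i (minimalPeriod_perm_pos π _)⟩⟩, ?_⟩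
    simp only
    rw [← Equiv.Perm.iterate_eq_pow, Function.iterate_mod_minimalPeriod_eq,
      Equiv.Perm.iterate_eq_pow, hi]

variable {κ R : Type*} [Fintype κ] [DecidableEq κ] [CommRing R]

/-- Expansion of matrix powers over walks, with the endpoints weighted by `g`. -/
lemma sum_walk_eq_sum_pow (A : Matrix κ κ R) (m : ℕ) (g : κ → κ → R) :
    ∑ c : Fin (m + 1) → κ, (∏ i : Fin m, A (c i.castSucc) (c i.succ)) * g (c (Fin.last m)) (c 0) =
      ∑ a, ∑ b, (A ^ m) a b * g b a := by
  induction m generalizing g with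
  | zero =>
    rw [← (Equiv.funUnique (Fin 1) κ).symm.sum_comp]
    simp [Matrix.one_apply]
  | succ m ih =>
    rw [← (Fin.snocEquiv fun _ => κ).sum_comp, Fintype.sum_prod_type_right]
    have := ih fun b a => ∑ x, A b x * g x a
    simp only [Finset.mul_sum] at this
    convert this using 2 with c _ a _
    · refine Finset.sum_congr rfl fun x _ => ?_
      rw [Fin.prod_univ_castSucc]
      have h0 : (Fin.snoc (α := fun _ => κ) c x : Fin (m + 2) → κ) 0 = c 0 := by
        rw [← Fin.castSucc_zero, Fin.snoc_castSucc]
      simp only [Fin.snocEquiv_apply, Fin.snoc_castSucc, Fin.succ_castSucc, Fin.succ_last,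
        Fin.snoc_last, h0]
      ring
    · simp only [pow_succ, Matrix.mul_apply, Finset.sum_mul]
      rw [Finset.sum_comm]
      refine Finset.sum_congr rfl fun x _ => Finset.sum_congr rfl fun b _ => ?_
      ring

/-- Expansion of the trace of a matrix power over closed walks. -/
lemma trace_pow_succ_eq_sum (A : Matrix κ κ R) (m : ℕ) :
    (A ^ (m + 1)).trace = ∑ c : Fin (m + 1) → κ, ∏ i, A (c i) (c (finRotate _ i)) := by
  have := sum_walk_eq_sum_pow A m A
  simp only [pow_succ, Matrix.trace, Matrix.diag, Matrix.mul_apply]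
  rw [← this]
  refine Finset.sum_congr rfl fun c _ => ?_
  rw [Fin.prod_univ_castSucc, finRotate_last]
  congr 1
  refine Finset.prod_congr rfl fun i _ => ?_
  congr 2
  ext
  simp

/-- The product of traces of powers over the cycles of `π`, written as a sum over colourings. -/
lemma prod_trace_pow_eq_sum (π : Equiv.Perm β) (A : Matrix κ κ R) :
    ∏ j ∈ cycleReps π, (A ^ Function.minimalPeriod π j).trace =
      ∑ f : β → κ, ∏ k, A (f k) (f (π k)) := by
  classical
  let e := Equiv.ofBijective _ (cycleReps_orbit_bijective π)
  have he (x) : e x = (π ^ (x.2 : ℕ)) (x.1 : β) := rfl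
  have htr (r : β) : (A ^ Function.minimalPeriod π r).trace =
      ∑ c : Fin (Function.minimalPeriod π r) → κ, ∏ i, A (c i) (c (finRotate _ i)) := by
    obtain ⟨m, hm⟩ := Nat.exists_eq_succ_of_ne_zero (minimalPeriod_perm_pos π r).ne'
    rw [hm]
    exact trace_pow_succ_eq_sum A m
  have hrot (r : cycleReps π) (i : Fin (Function.minimalPeriod π (r : β))) :
      π (e ⟨r, i⟩) = e ⟨r, finRotate _ i⟩ := by
    rw [he, he, ← Equiv.Perm.mul_apply, ← pow_succ']
    obtain ⟨m, hm⟩ := Nat.exists_eq_succ_of_ne_zero (minimalPeriod_perm_pos π (r : β)).ne'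
    have key : ((finRotate _ i : Fin (Function.minimalPeriod π (r : β))) : ℕ) =
        ((i : ℕ) + 1) % Function.minimalPeriod π (r : β) := by
      clear_value e
      revert i
      rw [hm]
      intro i
      rw [coe_finRotate]
      split_ifs with h
      · simp [h]
      · rw [Nat.mod_eq_of_lt]
        have := i.2
        have : (i : ℕ) ≠ m := fun h' => h (Fin.ext h')
        omega
    simp only [key]
    rw [← Equiv.Perm.iterate_eq_pow, ← Equiv.Perm.iterate_eq_pow,
      Function.iterate_mod_minimalPeriod_eq]
  rw [← Finset.prod_coe_sort]
  simp only [htr]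
  rw [Fintype.prod_sum, ← (Equiv.piCurry fun _ _ => κ).sum_comp,
    ← (Equiv.arrowCongr e (Equiv.refl κ)).sum_comp]
  refine Finset.sum_congr rfl fun f _ => ?_
  rw [← e.prod_comp, Fintype.prod_sigma]
  refine Finset.prod_congr rfl fun r _ => Finset.prod_congr rfl fun i _ => ?_
  rw [hrot]
  simp [Equiv.piCurry, Sigma.curry]

/-- The colourings invariant under `π` number `#κ ^ cycleCount π`. -/
lemma natCard_invariant (π : Equiv.Perm β) (κ : Type*) [Finite κ] :
    Nat.card {f : β → κ // ∀ k, f k = f (π k)} = Nat.card κ ^ cycleCount π := by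
  classical
  cases nonempty_fintype κ
  have h := prod_trace_pow_eq_sum π (1 : Matrix κ κ ℤ)
  simp only [one_pow, Matrix.trace_one, Finset.prod_const, Matrix.one_apply] at h
  simp only [Finset.prod_ite_zero, Finset.prod_const_one, Finset.sum_boole, Finset.mem_univ,
    true_imp_iff] at h
  rw [Nat.card_eq_fintype_card, Nat.card_eq_fintype_card, Fintype.card_subtype]
  exact_mod_cast h.symm

lemma cycleCount_eq_of_natCard {γ : Type*} [Fintype γ] [LinearOrder γ] {π : Equiv.Perm β}
    {ρ : Equiv.Perm γ} (m : ℕ)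
    (h : Nat.card {f : γ → Bool // ∀ k, f k = f (ρ k)} =
      2 ^ m * Nat.card {f : β → Bool // ∀ k, f k = f (π k)}) :
    cycleCount ρ = cycleCount π + m := by
  rw [natCard_invariant, natCard_invariant, Nat.card_eq_fintype_card, Fintype.card_bool,
    ← pow_add] at h
  rw [Nat.pow_right_injective le_rfl h, add_comm]

lemma cycleCount_mul_comm (α σ : Equiv.Perm β) : cycleCount (α * σ) = cycleCount (σ * α) := by
  refine cycleCount_eq_of_natCard 0 ?_
  rw [pow_zero, one_mul]
  refine Nat.card_congr ((Equiv.arrowCongr α.symm (Equiv.refl Bool)).subtypeEquiv fun f => ?_)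
  simp only [Equiv.arrowCongr_apply, Equiv.Perm.mul_apply, Equiv.symm_symm, Equiv.coe_refl,
    Function.comp_apply, id_eq]
  exact ⟨fun h k => h (α k), fun h k => by simpa using h (α.symm k)⟩

lemma cycleCount_decomposeFin_symm_zero {n : ℕ} (α : Equiv.Perm (Fin n)) :
    cycleCount (Equiv.Perm.decomposeFin.symm (0, α)) = cycleCount α + 1 := by
  refine cycleCount_eq_of_natCard 1 ?_
  have : 2 ^ 1 = Nat.card Bool := by simp
  rw [this, ← Nat.card_prod]
  refine Nat.card_congr ((((Fin.consEquiv fun _ => Bool).subtypeEquiv (p := fun x =>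
    ∀ k, x.2 k = x.2 (α k)) fun f => ?_).symm.trans ?_))
  · simp [Fin.forall_fin_succ, Fin.consEquiv]
  · exact
      { toFun := fun x => (x.1.1, ⟨x.1.2, x.2⟩)
        invFun := fun x => ⟨(x.1, x.2.1), x.2.2⟩
        left_inv := fun _ => rfl
        right_inv := fun _ => rfl }

lemma cycleCount_decomposeFin_symm_succ {n : ℕ} (α : Equiv.Perm (Fin n)) (j : Fin n) :
    cycleCount (Equiv.Perm.decomposeFin.symm (j.succ, α)) = cycleCount α := by
  refine cycleCount_eq_of_natCard (π := α) 0 ?_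
  rw [pow_zero, one_mul]
  have key (x : Bool) (f : Fin n → Bool) (hx : x = f j) (i : Fin n) :
      (Fin.cons x f : Fin (n + 1) → Bool) ((Equiv.swap 0 j.succ) i.succ) = f i := by
    by_cases h : i = j
    · subst h; simp [hx]
    · rw [Equiv.swap_apply_of_ne_of_ne (Fin.succ_ne_zero _) (by simpa using h), Fin.cons_succ]
  refine Nat.card_congr ((((Fin.consEquiv fun _ => Bool).subtypeEquiv (p := fun x =>
    x.1 = x.2 j ∧ ∀ k, x.2 k = x.2 (α k)) fun f => ?_).symm.trans ?_))
  · obtain ⟨x, f⟩ := f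
    simp only [Fin.forall_fin_succ, Fin.consEquiv, Equiv.coe_fn_mk, Fin.cons_zero,
      Equiv.Perm.decomposeFin_symm_apply_zero, Fin.cons_succ,
      Equiv.Perm.decomposeFin_symm_apply_succ]
    refine and_congr_right fun hx => forall_congr' fun k => ?_
    rw [key x f hx]
  · exact
      { toFun := fun x => ⟨x.1.2, x.2.2⟩
        invFun := fun x => ⟨(x.1 j, x.1), rfl, x.2⟩
        left_inv := fun x => Subtype.ext (Prod.ext x.2.1.symm rfl)
        right_inv := fun _ => rfl }

/-- The `p`-weighted sum over permutations attached to `M`. -/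
def permSum {n : ℕ} (p : ℂ) (M : Fin n → Fin n → ℂ) : ℂ :=
  ∑ α : Equiv.Perm (Fin n), p ^ cycleCount α * ∏ i, M i (α i)

/-- Expansion of `permSum` according to the position of `0` in the cycle decomposition. -/
lemma permSum_succ {n : ℕ} (p : ℂ) (M : Fin (n + 1) → Fin (n + 1) → ℂ) :
    permSum p M = ∑ α : Equiv.Perm (Fin n), p ^ cycleCount α *
      (p * M 0 0 * ∏ i : Fin n, M i.succ (α i).succ +
        ∑ j : Fin n, (∏ i ∈ Finset.univ.erase j, M i.succ (α i).succ) *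
          (M 0 (α j).succ * M j.succ 0)) := by
  rw [permSum, ← Equiv.Perm.decomposeFin.symm.sum_comp, Fintype.sum_prod_type_right]
  refine Finset.sum_congr rfl fun α _ => ?_
  rw [Fin.sum_univ_succ, cycleCount_decomposeFin_symm_zero, mul_add]
  congr 1
  · rw [Fin.prod_univ_succ]
    simp only [Equiv.Perm.decomposeFin_symm_apply_zero, Equiv.Perm.decomposeFin_symm_apply_succ,
      Equiv.swap_self, Equiv.refl_apply]
    ring
  · rw [← Equiv.sum_comp α, Finset.mul_sum]
    refine Finset.sum_congr rfl fun j _ => ?_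
    rw [cycleCount_decomposeFin_symm_succ, Fin.prod_univ_succ,
      ← Finset.mul_prod_erase Finset.univ _ (Finset.mem_univ j)]
    simp only [Equiv.Perm.decomposeFin_symm_apply_zero, Equiv.Perm.decomposeFin_symm_apply_succ,
      Equiv.swap_apply_right]
    have : ∏ i ∈ Finset.univ.erase j, M i.succ (Equiv.swap 0 (α j).succ (α i).succ) =
        ∏ i ∈ Finset.univ.erase j, M i.succ (α i).succ := by
      refine Finset.prod_congr rfl fun i hi => ?_
      rw [Equiv.swap_apply_of_ne_of_ne (Fin.succ_ne_zero _)]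
      simpa using Finset.ne_of_mem_erase hi
    rw [this]
    ring

end Combinatorics

section MatrixCalculus

variable {N : ℕ}

lemma eventually_posDef_sub_smul {A H : Matrix (Fin N) (Fin N) ℂ} (hA : A.PosDef)
    (hH : H.IsHermitian) : ∀ᶠ t : ℝ in nhds 0, (A - (t : ℂ) • H).PosDef := by
  have hherm (t : ℝ) : (A - (t : ℂ) • H).IsHermitian := by
    refine hA.isHermitian.sub ?_
    rw [Matrix.IsHermitian, Matrix.conjTranspose_smul, hH.eq]
    simp
  have hcont : Continuous fun z : ℝ × (Fin N → ℂ) =>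
      (star z.2 ⬝ᵥ (A - (z.1 : ℂ) • H) *ᵥ z.2).re := by
    fun_prop
  have hsphere : ∀ᶠ t : ℝ in nhds 0, ∀ x ∈ Metric.sphere (0 : Fin N → ℂ) 1,
      0 < (star x ⬝ᵥ (A - (t : ℂ) • H) *ᵥ x).re := by
    refine (isCompact_sphere (0 : Fin N → ℂ) 1).eventually_forall_of_forall_eventually
      (P := fun (t : ℝ) x => 0 < (star x ⬝ᵥ (A - (t : ℂ) • H) *ᵥ x).re) fun x hx => ?_
    refine hcont.continuousAt.eventually (lt_mem_nhds ?_)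
    have hx0 : x ≠ 0 := by
      rintro rfl
      simp at hx
    simpa using (Complex.pos_iff.1 (hA.dotProduct_mulVec_pos hx0)).1
  filter_upwards [hsphere] with t ht
  refine Matrix.PosDef.of_dotProduct_mulVec_pos (hherm t) fun x hx => ?_
  have hnorm : 0 < ‖x‖ := norm_pos_iff.2 hx
  have hu := ht ((‖x‖⁻¹ : ℂ) • x) (by
    rw [mem_sphere_zero_iff_norm, norm_smul]
    simp [hnorm.ne'])
  rw [Complex.pos_iff]
  refine ⟨?_, ?_⟩
  · rw [Matrix.mulVec_smul, star_smul, smul_dotProduct, dotProduct_smul, smul_eq_mul,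
      smul_eq_mul, ← mul_assoc] at hu
    have hc : (star (‖x‖⁻¹ : ℂ) * (‖x‖⁻¹ : ℂ)) = ((‖x‖⁻¹ * ‖x‖⁻¹ : ℝ) : ℂ) := by simp
    rw [hc, Complex.re_ofReal_mul] at hu
    exact pos_of_mul_pos_right hu (by positivity)
  · exact ((hherm t).im_star_dotProduct_mulVec_self x).symm

lemma hasDerivAt_det_sub_smul {A : Matrix (Fin N) (Fin N) ℂ} (hA : IsUnit A.det)
    (H : Matrix (Fin N) (Fin N) ℂ) :
    HasDerivAt (fun t : ℝ => (A - (t : ℂ) • H).det) (-(A.det * (A⁻¹ * H).trace)) 0 := by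
  have hfac (t : ℝ) : (A - (t : ℂ) • H).det = A.det * (1 + (t : ℂ) • (-(A⁻¹ * H))).det := by
    rw [← Matrix.det_mul, Matrix.mul_add, Matrix.mul_one, Matrix.mul_smul, Matrix.mul_neg,
      Matrix.mul_nonsing_inv_cancel_left A H hA, smul_neg, sub_eq_add_neg]
  let q := (1 + (Polynomial.X : Polynomial ℂ) • (-(A⁻¹ * H)).map Polynomial.C).det.divX.divX
  have hexp : (fun t : ℝ => (A - (t : ℂ) • H).det) = fun t : ℝ =>
      A.det * (1 + (-(A⁻¹ * H)).trace * (t : ℂ) + q.eval (t : ℂ) * (t : ℂ) ^ 2) :=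
    funext fun t => by rw [hfac, Matrix.det_one_add_smul]
  rw [hexp]
  clear_value q
  have hid : HasDerivAt (fun t : ℝ => (t : ℂ)) 1 0 := Complex.ofRealCLM.hasDerivAt
  have hq : HasDerivAt (fun t : ℝ => q.eval (t : ℂ)) (q.derivative.eval 0 * 1) 0 := by
    have := q.hasDerivAt (0 : ℂ)
    exact HasDerivAt.comp (h₂ := fun z => q.eval z) (0 : ℝ) (by simpa using this) hid
  have := (((hid.const_mul (-(A⁻¹ * H)).trace).const_add 1).add (hq.mul (hid.pow 2))).const_mul
    A.det
  refine this.congr_deriv ?_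
  simp

lemma hasDerivAt_inv_sub_smul_apply {A : Matrix (Fin N) (Fin N) ℂ} (hA : IsUnit A.det)
    (H : Matrix (Fin N) (Fin N) ℂ) (a b : Fin N) :
    HasDerivAt (fun t : ℝ => (A - (t : ℂ) • H)⁻¹ a b) ((A⁻¹ * H * A⁻¹) a b) 0 := by
  have hdet := hasDerivAt_det_sub_smul hA H
  have hunit : ∀ᶠ t : ℝ in nhds 0, IsUnit (A - (t : ℂ) • H).det := by
    have h0 : (A - ((0 : ℝ) : ℂ) • H).det ≠ 0 := by simpa using hA.ne_zero
    filter_upwards [hdet.continuousAt.eventually_ne h0] with t ht using ht.isUnit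
  have h0 : A - ((0 : ℝ) : ℂ) • H = A := by simp
  have hcont : ContinuousAt (fun t : ℝ => ((A - (t : ℂ) • H)⁻¹ * H * A⁻¹) a b) 0 := by
    have hinv : ContinuousAt (fun t : ℝ => (A - (t : ℂ) • H)⁻¹) 0 := by
      simp only [Matrix.inv_def, Ring.inverse_eq_inv]
      refine ContinuousAt.smul (hdet.continuousAt.inv₀ (by rw [h0]; exact hA.ne_zero)) ?_
      fun_prop
    have h2 : Continuous fun M : Matrix (Fin N) (Fin N) ℂ => (M * H * A⁻¹) a b := by fun_prop
    exact h2.continuousAt.comp hinv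
  have hid : HasDerivAt (fun t : ℝ => (t : ℂ)) 1 0 := Complex.ofRealCLM.hasDerivAt
  rw [hasDerivAt_iff_tendsto_slope]
  have hlim : Tendsto (fun t : ℝ => ((A - (t : ℂ) • H)⁻¹ * H * A⁻¹) a b) (nhdsWithin 0 {0}ᶜ)
      (nhds ((A⁻¹ * H * A⁻¹) a b)) := by
    have := hcont.tendsto.mono_left (nhdsWithin_le_nhds (s := {0}ᶜ))
    rwa [h0] at this
  refine hlim.congr' ?_
  filter_upwards [nhdsWithin_le_nhds hunit, self_mem_nhdsWithin] with t ht ht0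
  have hne : (t : ℂ) ≠ 0 := by simpa using ht0
  rw [slope_def_module, h0, sub_zero, ← Matrix.sub_apply,
    Matrix.inv_sub_inv (iff_of_true ((Matrix.isUnit_iff_isUnit_det _).2 ht)
      ((Matrix.isUnit_iff_isUnit_det _).2 hA)), sub_sub_cancel, Matrix.mul_smul, Matrix.smul_mul,
    Matrix.smul_apply, Complex.real_smul, smul_eq_mul, Complex.ofReal_inv, inv_mul_cancel_left₀ hne]

/-- Derivative in the direction `H` of `det A ^ (-p) * permSum p (A⁻¹)`, `A` being shifted
by `- t • H`. -/
def momentDeriv {n : ℕ} (p : ℂ) (A : Matrix (Fin N) (Fin N) ℂ) (a b : Fin n → Fin N)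
    (H : Matrix (Fin N) (Fin N) ℂ) : ℂ :=
  A.det ^ (-p) * ∑ α : Equiv.Perm (Fin n), p ^ cycleCount α *
    (p * (A⁻¹ * H).trace * ∏ i, A⁻¹ (a i) (b (α i)) +
      ∑ j, (∏ i ∈ Finset.univ.erase j, A⁻¹ (a i) (b (α i))) * (A⁻¹ * H * A⁻¹) (a j) (b (α j)))

lemma hasDerivAt_moment {n : ℕ} (p : ℂ) {A : Matrix (Fin N) (Fin N) ℂ} (hA : A.PosDef)
    (a b : Fin n → Fin N) (H : Matrix (Fin N) (Fin N) ℂ) :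
    HasDerivAt (fun t : ℝ => (A - (t : ℂ) • H).det ^ (-p) *
      permSum p fun i j => (A - (t : ℂ) • H)⁻¹ (a i) (b j)) (momentDeriv p A a b H) 0 := by
  have hdet : A.det ≠ 0 := hA.det_pos.ne'
  have hslit : A.det ∈ Complex.slitPlane := by
    rw [Complex.mem_slitPlane_iff]
    exact Or.inl (Complex.pos_iff.1 hA.det_pos).1
  have h1 : HasDerivAt (fun t : ℝ => (A - (t : ℂ) • H).det ^ (-p))
      (A.det ^ (-p) * (p * (A⁻¹ * H).trace)) 0 := by
    have hd := hasDerivAt_det_sub_smul hdet.isUnit H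
    have hout : HasDerivAt (fun z : ℂ => z ^ (-p)) (-p * A.det ^ (-p - 1))
        ((A - ((0 : ℝ) : ℂ) • H).det) := by
      have := (hasDerivAt_id A.det).cpow_const (c := -p) hslit
      simpa using this
    refine (HasDerivAt.comp (0 : ℝ) hout hd).congr_deriv ?_
    rw [Complex.cpow_sub _ _ hdet, Complex.cpow_one]
    field_simp
  have h2 : HasDerivAt (fun t : ℝ => permSum p fun i j => (A - (t : ℂ) • H)⁻¹ (a i) (b j))
      (∑ α : Equiv.Perm (Fin n), p ^ cycleCount α *
        ∑ j, (∏ i ∈ Finset.univ.erase j, A⁻¹ (a i) (b (α i))) *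
          (A⁻¹ * H * A⁻¹) (a j) (b (α j))) 0 := by
    unfold permSum
    refine HasDerivAt.fun_sum fun α _ => HasDerivAt.const_mul _ ?_
    refine (HasDerivAt.fun_finsetProd fun i _ =>
      hasDerivAt_inv_sub_smul_apply hdet.isUnit H (a i) (b (α i))).congr_deriv ?_
    simp
  refine (h1.mul h2).congr_deriv ?_
  simp only [Complex.ofReal_zero, zero_smul, sub_zero, momentDeriv, permSum, mul_add,
    Finset.sum_add_distrib]
  congr 1
  rw [Finset.mul_sum, Finset.mul_sum]
  exact Finset.sum_congr rfl fun α _ => by ring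

lemma momentDeriv_add_smul {n : ℕ} (p : ℂ) (A : Matrix (Fin N) (Fin N) ℂ) (a b : Fin n → Fin N)
    (H K : Matrix (Fin N) (Fin N) ℂ) (c : ℂ) :
    momentDeriv p A a b (H + c • K) = momentDeriv p A a b H + c * momentDeriv p A a b K := by
  unfold momentDeriv
  rw [mul_left_comm c, ← mul_add]
  congr 1
  rw [Finset.mul_sum, ← Finset.sum_add_distrib]
  refine Finset.sum_congr rfl fun α _ => ?_
  simp only [Matrix.mul_smul, Matrix.smul_mul, Matrix.trace_add, Matrix.trace_smul,
    Matrix.add_apply, Matrix.smul_apply, smul_eq_mul, mul_add, Finset.sum_add_distrib, add_mul]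
  have hcomm (x y : ℂ) : x * (c * y) = c * (x * y) := mul_left_comm x c y
  simp only [hcomm, ← Finset.mul_sum]
  ring

lemma momentDeriv_single {n : ℕ} (p : ℂ) (A : Matrix (Fin N) (Fin N) ℂ)
    (a b : Fin (n + 1) → Fin N) :
    momentDeriv p A (fun i => a i.succ) (fun i => b i.succ) (Matrix.single (b 0) (a 0) 1) =
      A.det ^ (-p) * permSum p fun i j => A⁻¹ (a i) (b j) := by
  have h (x y : Fin N) :
      (A⁻¹ * (Matrix.single (b 0) (a 0) 1 : Matrix (Fin N) (Fin N) ℂ) * A⁻¹) x y =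
        A⁻¹ (a 0) y * A⁻¹ x (b 0) := by
    rw [Matrix.mul_assoc, Matrix.mul_apply, Finset.sum_eq_single (b 0)]
    · simp [mul_comm]
    · intro z _ hz
      rw [Matrix.single_mul_apply_of_ne _ _ _ _ _ hz, mul_zero]
    · simp
  rw [permSum_succ, momentDeriv]
  simp only [h, Matrix.trace_mul_single, MulOpposite.op_one, one_smul]

end MatrixCalculus

section Wishart

variable {N : ℕ} {Ω : Type*} [MeasurableSpace Ω] {μ : Measure Ω}
  {W : Ω → Matrix (Fin N) (Fin N) ℂ}

lemma measurable_entry (hW : Measurable W) (a b : Fin N) : Measurable fun ω => W ω a b :=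
  measurable_pi_iff.1 (measurable_pi_iff.1 hW a) b

lemma measurable_trace_mul (hW : Measurable W) (H : Matrix (Fin N) (Fin N) ℂ) :
    Measurable fun ω => (H * W ω).trace := by
  simp only [Matrix.trace, Matrix.diag, Matrix.mul_apply]
  exact Finset.measurable_sum _ fun i _ => Finset.measurable_sum _ fun j _ =>
    (measurable_entry hW j i).const_mul _

lemma trace_mul_im_eq_zero {A B : Matrix (Fin N) (Fin N) ℂ} (hA : A.IsHermitian)
    (hB : B.IsHermitian) : (A * B).trace.im = 0 := by
  rw [← Complex.conj_eq_iff_im, starRingEnd_apply, ← Matrix.trace_conjTranspose,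
    Matrix.conjTranspose_mul, hA.eq, hB.eq, Matrix.trace_mul_comm]

lemma abs_mul_exp_le {δ : ℝ} (hδ : 0 < δ) {t x : ℝ} (ht : |t| ≤ δ) :
    |x| * Real.exp (t * x) ≤ δ⁻¹ * (Real.exp (2 * δ * x) + Real.exp (-(2 * δ) * x)) := by
  have h1 : |x| ≤ δ⁻¹ * Real.exp (δ * |x|) := by
    rw [inv_mul_eq_div, le_div_iff₀ hδ]
    have := Real.add_one_le_exp (δ * |x|)
    linarith
  have h2 : Real.exp (t * x) ≤ Real.exp (δ * |x|) := by
    refine Real.exp_le_exp.2 ((le_abs_self _).trans ?_)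
    rw [abs_mul]
    gcongr
  have h3 : Real.exp (2 * δ * |x|) ≤ Real.exp (2 * δ * x) + Real.exp (-(2 * δ) * x) := by
    rcases abs_cases x with ⟨h, _⟩ | ⟨h, _⟩ <;> rw [h]
    · linarith [Real.exp_pos (-(2 * δ) * x)]
    · rw [mul_neg, ← neg_mul]
      linarith [Real.exp_pos (2 * δ * x)]
  calc |x| * Real.exp (t * x) ≤ (δ⁻¹ * Real.exp (δ * |x|)) * Real.exp (δ * |x|) := by gcongr
    _ = δ⁻¹ * Real.exp (2 * δ * |x|) := by rw [mul_assoc, ← Real.exp_add]; ring_nf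
    _ ≤ _ := by gcongr

/-- Differentiation under the integral sign for exponentially tilted integrals. -/
lemma hasDerivAt_integral_tilt (hmeas : Measurable W) (hherm : ∀ ω, (W ω).IsHermitian)
    {F : Ω → ℂ} (hF : Measurable F)
    (hint : ∀ θ : Matrix (Fin N) (Fin N) ℂ, θ.IsHermitian → (1 - θ).PosDef →
      Integrable (fun ω => F ω * Complex.exp (θ * W ω).trace) μ)
    {θ H : Matrix (Fin N) (Fin N) ℂ} (hθ : θ.IsHermitian) (hpos : (1 - θ).PosDef)
    (hH : H.IsHermitian) :
    Integrable (fun ω => (H * W ω).trace * (F ω * Complex.exp (θ * W ω).trace)) μ ∧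
      HasDerivAt (fun t : ℝ => ∫ ω, F ω * Complex.exp ((θ + (t : ℂ) • H) * W ω).trace ∂μ)
        (∫ ω, (H * W ω).trace * (F ω * Complex.exp (θ * W ω).trace) ∂μ) 0 := by
  have hθt (t : ℝ) : (θ + (t : ℂ) • H).IsHermitian := by
    refine hθ.add ?_
    rw [Matrix.IsHermitian, Matrix.conjTranspose_smul, hH.eq]
    simp
  have hsplit (t : ℝ) (ω : Ω) : ((θ + (t : ℂ) • H) * W ω).trace =
      (θ * W ω).trace + t * (H * W ω).trace := by
    rw [Matrix.add_mul, Matrix.trace_add, Matrix.smul_mul, Matrix.trace_smul, smul_eq_mul]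
  obtain ⟨ε, hε, hball⟩ := Metric.eventually_nhds_iff.1 (eventually_posDef_sub_smul hpos hH)
  have hgood (t : ℝ) (ht : |t| < ε) :
      Integrable (fun ω => F ω * Complex.exp ((θ + (t : ℂ) • H) * W ω).trace) μ := by
    refine hint _ (hθt t) ?_
    rw [← sub_sub]
    exact hball (by simpa using ht)
  have hδ : 0 < ε / 3 := by positivity
  set δ := ε / 3 with hδ_def
  have hb1 := hgood (2 * δ) (by rw [abs_of_pos (by positivity)]; linarith)
  have hb2 := hgood (-(2 * δ)) (by rw [abs_neg, abs_of_pos (by positivity)]; linarith)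
  have hmF (t : ℝ) : Measurable fun ω => F ω * Complex.exp ((θ + (t : ℂ) • H) * W ω).trace :=
    hF.mul (measurable_trace_mul hmeas _).cexp
  have hnorm (t : ℝ) (ω : Ω) : ‖Complex.exp ((θ + (t : ℂ) • H) * W ω).trace‖ =
      Real.exp (θ * W ω).trace.re * Real.exp (t * (H * W ω).trace.re) := by
    rw [Complex.norm_exp, hsplit, Complex.add_re, Complex.re_ofReal_mul, Real.exp_add]
  have := hasDerivAt_integral_of_dominated_loc_of_deriv_le (μ := μ) (𝕜 := ℝ) (x₀ := 0)
    (s := Metric.ball 0 δ)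
    (F := fun t ω => F ω * Complex.exp ((θ + (t : ℂ) • H) * W ω).trace)
    (F' := fun t ω => (H * W ω).trace * (F ω * Complex.exp ((θ + (t : ℂ) • H) * W ω).trace))
    (bound := fun ω => δ⁻¹ *
      (‖F ω * Complex.exp ((θ + ((2 * δ : ℝ) : ℂ) • H) * W ω).trace‖ +
        ‖F ω * Complex.exp ((θ + ((-(2 * δ) : ℝ) : ℂ) • H) * W ω).trace‖))
    (Metric.ball_mem_nhds _ hδ)
    (Eventually.of_forall fun t => (hmF t).aestronglyMeasurable)
    (hgood 0 (by simpa using hε))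
    ((measurable_trace_mul hmeas H).mul (hmF 0)).aestronglyMeasurable
    (ae_of_all _ fun ω t ht => ?_)
    ((hb1.norm.add hb2.norm).const_mul _)
    (ae_of_all _ fun ω t _ => ?_)
  · simpa using this
  · have ht' : |t| ≤ δ := by simpa using (mem_ball_zero_iff.1 ht).le
    have hX : ‖(H * W ω).trace‖ = |(H * W ω).trace.re| := by
      rw [← Complex.re_add_im (H * W ω).trace, trace_mul_im_eq_zero hH (hherm ω)]
      simp
    have hle := abs_mul_exp_le hδ (x := (H * W ω).trace.re) ht'
    simp only [norm_mul, hnorm, hX]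
    calc _ = (‖F ω‖ * Real.exp (θ * W ω).trace.re) *
          (|(H * W ω).trace.re| * Real.exp (t * (H * W ω).trace.re)) := by ring
      _ ≤ (‖F ω‖ * Real.exp (θ * W ω).trace.re) * _ :=
          mul_le_mul_of_nonneg_left hle (by positivity)
      _ = _ := by ring
  · simp only [hsplit]
    have hid : HasDerivAt (fun t : ℝ => (t : ℂ)) 1 t := Complex.ofRealCLM.hasDerivAt
    refine ((((hid.mul_const (H * W ω).trace).const_add (θ * W ω).trace).cexp).const_mul
      (F ω)).congr_deriv ?_
    ring

/-- Joint entry moments of a complex Wishart matrix with identity scale, under tilting. -/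
lemma IsWishart.integral_prod_entry_mul_exp {p : ℝ} (hmeas : Measurable W)
    (hW : IsWishart μ W (1 : Matrix (Fin N) (Fin N) ℂ) p) {n : ℕ} (a b : Fin n → Fin N)
    {θ : Matrix (Fin N) (Fin N) ℂ} (hθ : θ.IsHermitian) (hpos : (1 - θ).PosDef) :
    Integrable (fun ω => (∏ k, W ω (a k) (b k)) * Complex.exp (θ * W ω).trace) μ ∧
      ∫ ω, (∏ k, W ω (a k) (b k)) * Complex.exp (θ * W ω).trace ∂μ =
        (1 - θ).det ^ (-(p : ℂ)) * permSum p fun i j => (1 - θ)⁻¹ (a i) (b j) := by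
  induction n generalizing θ with
  | zero =>
    have h := hW.2 θ hθ (by simpa using hpos)
    have hsum : (permSum p fun i j : Fin 0 => (1 - θ)⁻¹ (a i) (b j)) = 1 := by
      simp [permSum, cycleCount, cycleReps]
    simp only [Finset.univ_eq_empty, Finset.prod_empty, one_mul, hsum, mul_one] at h ⊢
    refine ⟨?_, h⟩
    by_contra hni
    rw [integral_undef hni] at h
    exact (Complex.cpow_ne_zero_iff.2 (Or.inl hpos.det_pos.ne')) h.symm
  | succ n ih =>
    set a' : Fin n → Fin N := fun i => a i.succ
    set b' : Fin n → Fin N := fun i => b i.succ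
    set F : Ω → ℂ := fun ω => ∏ k, W ω (a' k) (b' k)
    have hF : Measurable F := Finset.measurable_prod _ fun k _ => measurable_entry hmeas _ _
    have hherm (H : Matrix (Fin N) (Fin N) ℂ) (hH : H.IsHermitian) :
        Integrable (fun ω => (H * W ω).trace * (F ω * Complex.exp (θ * W ω).trace)) μ ∧
          ∫ ω, (H * W ω).trace * (F ω * Complex.exp (θ * W ω).trace) ∂μ =
            momentDeriv p (1 - θ) a' b' H := by
      obtain ⟨hi, hd⟩ := hasDerivAt_integral_tilt (μ := μ) hmeas hW.1 hF
        (fun θ' h1 h2 => (ih a' b' h1 h2).1) hθ hpos hH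
      refine ⟨hi, hd.unique ((hasDerivAt_moment p hpos a' b' H).congr_of_eventuallyEq ?_)⟩
      filter_upwards [eventually_posDef_sub_smul hpos hH] with t ht
      rw [sub_sub] at ht ⊢
      refine (ih a' b' (hθ.add ?_) ht).2
      rw [Matrix.IsHermitian, Matrix.conjTranspose_smul, hH.eq]
      simp
    have hall (H : Matrix (Fin N) (Fin N) ℂ) :
        Integrable (fun ω => (H * W ω).trace * (F ω * Complex.exp (θ * W ω).trace)) μ ∧
          ∫ ω, (H * W ω).trace * (F ω * Complex.exp (θ * W ω).trace) ∂μ =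
            momentDeriv p (1 - θ) a' b' H := by
      obtain ⟨h1, h2⟩ := hherm (realPart H : Matrix (Fin N) (Fin N) ℂ) (realPart H).2
      obtain ⟨h3, h4⟩ := hherm (imaginaryPart H : Matrix (Fin N) (Fin N) ℂ) (imaginaryPart H).2
      rw [← realPart_add_I_smul_imaginaryPart H, momentDeriv_add_smul]
      simp only [Matrix.smul_mul, Matrix.trace_add, Matrix.trace_smul,
        smul_eq_mul, add_mul, mul_assoc Complex.I]
      exact ⟨h1.add (h3.const_mul _), by
        rw [integral_add h1 (h3.const_mul _), integral_const_mul, h2, h4]⟩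
    have h := hall (Matrix.single (b 0) (a 0) 1)
    simp only [Matrix.trace_single_mul, one_smul] at h
    rw [momentDeriv_single] at h
    simpa only [Fin.prod_univ_succ, mul_assoc] using h

end Wishart

/-- Hanlon–Stanley–Stembridge formula: if `σ ∈ S_n` has cycle type `λ ⊢ n` (so that
`p_λ(W) = ∏_{c ∈ C(σ)} tr(W^{#c})`), and `W` is complex Wishart with scale `I_N` and shape `p`,
then `E(p_λ(W)) = ∑_{α ∈ S_n} p^{#C(α)} N^{#C(ασ)}`. -/
theorem wishart_powerSum_moment
    {N n : ℕ} (hN : 1 ≤ N) (hn : 1 ≤ n)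
    {Ω : Type*} [MeasurableSpace Ω] (μ : Measure Ω) [IsProbabilityMeasure μ]
    (p : ℝ) (hp : ShapeParam N p)
    (W : Ω → Matrix (Fin N) (Fin N) ℂ) (hmeas : Measurable W)
    (hW : IsWishart μ W (1 : Matrix (Fin N) (Fin N) ℂ) p)
    (σ : Equiv.Perm (Fin n)) :
    ∫ ω, ∏ j ∈ cycleReps σ, (W ω ^ Function.minimalPeriod ⇑σ j).trace ∂μ =
      ∑ α : Equiv.Perm (Fin n), (p : ℂ) ^ cycleCount α * (N : ℂ) ^ cycleCount (α * σ) := by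
  have hmom (f : Fin n → Fin N) := IsWishart.integral_prod_entry_mul_exp hmeas hW f
    (fun k => f (σ k)) Matrix.isHermitian_zero (by simpa using Matrix.PosDef.one)
  simp only [Matrix.zero_mul, Matrix.trace_zero, Complex.exp_zero, mul_one, sub_zero,
    Matrix.det_one, Complex.one_cpow, one_mul, inv_one] at hmom
  simp only [prod_trace_pow_eq_sum]
  rw [integral_finsetSum _ fun f _ => (hmom f).1]
  simp only [(hmom _).2, permSum]
  rw [Finset.sum_comm]
  refine Finset.sum_congr rfl fun α _ => ?_
  rw [← Finset.mul_sum]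
  congr 1
  have hcount := natCard_invariant (σ * α) (Fin N)
  rw [Nat.card_eq_fintype_card, Fintype.card_subtype, Nat.card_fin,
    ← cycleCount_mul_comm] at hcount
  simp only [Matrix.one_apply, Finset.prod_ite_zero, Finset.prod_const_one, Finset.sum_boole,
    Finset.mem_univ, true_imp_iff]
  exact_mod_cast hcount

end
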